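/- arXiv:2302.07722 — 5 statements merged into one kernel-verified Lean document; each statement's English description precedes it below -/
import Mathlib

section
/- Let (X, μ) be a finite measure space and set 𝔥 = μ(X)/2. Let ε, η > 0. Let Ω, Θ be measurable sets with μ(Ω) ≤ 𝔥, μ(Θ) ≤ 𝔥 and μ(Ω Δ Θ) < ε, and let t, r ∈ [0,1] with |t − r| < η. Let B ⊆ B′ be measurable sets such that μ(B \ Ω) = t(𝔥 − μ(Ω)) and μ(B′ \ Θ) = r(𝔥 − μ(Θ)). Then μ((B′ \ B) \ Θ) ≤ 2η𝔥 + 2ε. -/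
open MeasureTheory Set

/-- Key quantitative estimate: with `𝔥 = μ(X)/2`, if `μ(Ω), μ(Θ) ≤ 𝔥`,
`μ(Ω Δ Θ) < ε`, `|t − r| < η`, `B ⊆ B'`, `μ(B \ Ω) = t(𝔥 − μΩ)` and
`μ(B' \ Θ) = r(𝔥 − μΘ)`, then `μ((B' \ B) \ Θ) ≤ 2η𝔥 + 2ε`. -/
theorem measure_diff_diff_le
    {X : Type*} [MeasurableSpace X] (μ : Measure X) [IsFiniteMeasure μ]
    (𝔥 : ℝ) (h𝔥 : 𝔥 = (μ Set.univ).toReal / 2)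
    (ε η : ℝ) (hε : 0 < ε) (hη : 0 < η)
    (Ω Θ B B' : Set X)
    (hΩm : MeasurableSet Ω) (hΘm : MeasurableSet Θ)
    (hBm : MeasurableSet B) (hB'm : MeasurableSet B')
    (hΩ : (μ Ω).toReal ≤ 𝔥) (hΘ : (μ Θ).toReal ≤ 𝔥)
    (hsym : (μ (symmDiff Ω Θ)).toReal < ε)
    (t r : ℝ) (ht : t ∈ Set.Icc (0:ℝ) 1) (hr : r ∈ Set.Icc (0:ℝ) 1)
    (htr : |t - r| < η)
    (hBB' : B ⊆ B')
    (hB : (μ (B \ Ω)).toReal = t * (𝔥 - (μ Ω).toReal))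
    (hB' : (μ (B' \ Θ)).toReal = r * (𝔥 - (μ Θ).toReal)) :
    (μ ((B' \ B) \ Θ)).toReal ≤ 2 * η * 𝔥 + 2 * ε := by
  have e1 : μ.real (B' \ Θ) = μ.real (B \ Θ) + μ.real ((B' \ B) \ Θ) := by
    rw [← measureReal_union _ ((hB'm.diff hBm).diff hΘm)]
    · congr 1
      ext x
      have := @hBB' x
      simp only [mem_diff, mem_union]
      tauto
    · rw [Set.disjoint_left]
      rintro x ⟨h1, _⟩ ⟨⟨_, h2⟩, _⟩
      exact h2 h1
  have e2 : μ.real (B \ Ω) ≤ μ.real (B \ Θ) + μ.real (symmDiff Ω Θ) := by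
    refine le_trans (measureReal_mono ?_) (measureReal_union_le _ _)
    intro x
    simp only [mem_diff, mem_union, mem_symmDiff]
    tauto
  have e3 : μ.real Ω ≤ μ.real Θ + μ.real (symmDiff Ω Θ) := by
    refine le_trans (measureReal_mono ?_) (measureReal_union_le _ _)
    intro x
    simp only [mem_union, mem_symmDiff]
    tauto
  have p : 0 ≤ μ.real Θ := measureReal_nonneg
  change μ.real _ ≤ _
  change μ.real _ < _ at hsym
  change μ.real _ = t * (𝔥 - μ.real _) at hB
  change μ.real _ = r * (𝔥 - μ.real _) at hB'
  change μ.real _ ≤ _ at hΘ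
  obtain ⟨t0, t1⟩ := ht
  have hrt : r - t ≤ η := by
    have := (abs_lt.mp htr).1
    linarith
  have a1 : (r - t) * (𝔥 - μ.real Θ) ≤ η * (𝔥 - μ.real Θ) :=
    mul_le_mul_of_nonneg_right hrt (by linarith)
  have a2 : t * (μ.real Ω - μ.real Θ) ≤ t * ε :=
    mul_le_mul_of_nonneg_left (by linarith) t0
  have a3 : t * ε ≤ 1 * ε := mul_le_mul_of_nonneg_right t1 hε.le
  have a4 : 0 ≤ η * μ.real Θ := by positivity
  have a5 : 0 ≤ η * 𝔥 := mul_nonneg hη.le (by linarith)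
  linarith
end

section
/- Let (X, μ) be a finite measure space and set 𝔥 = μ(X)/2. Let ε, η > 0. Let Ω, Θ be measurable sets with μ(Ω) ≤ 𝔥, μ(Θ) ≤ 𝔥 and μ(Ω Δ Θ) < ε, and let t, r ∈ [0,1] with |t − r| < η. Let B ⊆ B′ be measurable sets such that μ(B \ Ω) = t(𝔥 − μ(Ω)) and μ(B′ \ Θ) = r(𝔥 − μ(Θ)). Then μ((Ω ∪ B) Δ (Θ ∪ B′)) ≤ 2η𝔥 + 5ε. -/
open MeasureTheory Set

/-- Main quantitative continuity estimate behind Proposition 2.1: with `𝔥 = μ(X)/2`,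
if `μ(Ω), μ(Θ) ≤ 𝔥`, `μ(Ω Δ Θ) < ε`, `|t − r| < η`, `B ⊆ B'`,
`μ(B \ Ω) = t(𝔥 − μΩ)` and `μ(B' \ Θ) = r(𝔥 − μΘ)`, then
`μ((Ω ∪ B) Δ (Θ ∪ B')) ≤ 2η𝔥 + 5ε`. -/
theorem measure_symmDiff_union_le
    {X : Type*} [MeasurableSpace X] (μ : Measure X) [IsFiniteMeasure μ]
    (𝔥 : ℝ) (h𝔥 : 𝔥 = (μ Set.univ).toReal / 2)
    (ε η : ℝ) (hε : 0 < ε) (hη : 0 < η)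
    (Ω Θ B B' : Set X)
    (hΩm : MeasurableSet Ω) (hΘm : MeasurableSet Θ)
    (hBm : MeasurableSet B) (hB'm : MeasurableSet B')
    (hΩ : (μ Ω).toReal ≤ 𝔥) (hΘ : (μ Θ).toReal ≤ 𝔥)
    (hsym : (μ (symmDiff Ω Θ)).toReal < ε)
    (t r : ℝ) (ht : t ∈ Set.Icc (0:ℝ) 1) (hr : r ∈ Set.Icc (0:ℝ) 1)
    (htr : |t - r| < η)
    (hBB' : B ⊆ B')
    (hB : (μ (B \ Ω)).toReal = t * (𝔥 - (μ Ω).toReal))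
    (hB' : (μ (B' \ Θ)).toReal = r * (𝔥 - (μ Θ).toReal)) :
    (μ (symmDiff (Ω ∪ B) (Θ ∪ B'))).toReal ≤ 2 * η * 𝔥 + 5 * ε := by
  have hP : μ.real (Ω ∪ B) = μ.real Ω + μ.real (B \ Ω) := by
    rw [← Set.union_sdiff_self]
    exact measureReal_union disjoint_sdiff_self_right (hBm.diff hΩm)
  have hQ : μ.real (Θ ∪ B') = μ.real Θ + μ.real (B' \ Θ) := by
    rw [← Set.union_sdiff_self]
    exact measureReal_union disjoint_sdiff_self_right (hB'm.diff hΘm)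
  have h1 := measureReal_sdiff_add_inter (μ := μ) (s := Ω ∪ B) (hΘm.union hB'm)
  have h2 := measureReal_sdiff_add_inter (μ := μ) (s := Θ ∪ B') (hΩm.union hBm)
  rw [Set.inter_comm] at h2
  have h3 : μ.real ((Ω ∪ B) \ (Θ ∪ B')) ≤ μ.real (symmDiff Ω Θ) := by
    refine measureReal_mono ?_
    rintro x ⟨hx, hn⟩
    have := @hBB' x
    simp only [Set.mem_union, Set.mem_symmDiff] at *
    tauto
  have h4 : μ.real (symmDiff (Ω ∪ B) (Θ ∪ B')) ≤
      μ.real ((Ω ∪ B) \ (Θ ∪ B')) + μ.real ((Θ ∪ B') \ (Ω ∪ B)) :=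
    measureReal_union_le _ _
  have h5 : μ.real Θ ≤ μ.real Ω + μ.real (symmDiff Ω Θ) := by
    refine le_trans (measureReal_mono ?_) (measureReal_union_le _ _)
    intro x hx
    simp only [Set.mem_union, Set.mem_symmDiff]
    tauto
  have h0 : 0 ≤ μ.real Ω := measureReal_nonneg
  simp only [← measureReal_def] at *
  obtain ⟨hr0, hr1⟩ := hr
  have hd : r - t ≤ η := by linarith [(abs_lt.mp htr).1]
  have h6 : (1 - r) * (μ.real Θ - μ.real Ω) ≤ ε := by
    nlinarith
  have h7 : (r - t) * (𝔥 - μ.real Ω) ≤ η * 𝔥 := by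
    nlinarith
  have h8 : 0 ≤ η * 𝔥 := mul_nonneg hη.le (h0.trans hΩ)
  nlinarith
end

section
/- Let (X, μ) be a finite measure space, set 𝔥 = μ(X)/2, and let (B_s)_{s ∈ [0,𝔥]} be a family of measurable sets with B_s ⊆ B_{s′} whenever s ≤ s′ and μ(B_s) = s for every s ∈ [0,𝔥]. Let 𝒞 denote the collection of measurable sets Ω with μ(Ω) ≤ 𝔥, and suppose s : 𝒞 × [0,1] → [0,𝔥] is any function satisfying μ(Ω ∪ B_{s(Ω,t)}) = μ(Ω) + t(𝔥 − μ(Ω)) for all (Ω,t). Define φ(Ω,t) = Ω ∪ B_{s(Ω,t)}. Then φ is continuous with respect to the symmetric-difference pseudometric: for every Ω ∈ 𝒞, every t ∈ [0,1], and every ε₀ > 0, there exists δ > 0 such that for all Θ ∈ 𝒞 and r ∈ [0,1] with μ(Ω Δ Θ) < δ and |t − r| < δ, one has μ(φ(Ω,t) Δ φ(Θ,r)) < ε₀. -/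
open MeasureTheory Set

theorem aux_le {X : Type*} [MeasurableSpace X] (μ : Measure X) [IsFiniteMeasure μ]
    (A C D : Set X) (h : A ⊆ C ∪ D) : μ.real A ≤ μ.real C + μ.real D :=
  (measureReal_mono h).trans (measureReal_union_le C D)

theorem aux_nested {X : Type*} [MeasurableSpace X] (μ : Measure X) [IsFiniteMeasure μ]
    (P Q : Set X) (hP : MeasurableSet P) (h : P ⊆ Q) :
    μ.real (symmDiff P Q) = μ.real Q - μ.real P := by
  rw [← measureReal_diff h hP]
  congr 1
  ext x
  have := @h x
  simp only [Set.mem_symmDiff, Set.mem_diff]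
  tauto

/-- Continuity of the volume-adjustment map `φ(Ω,t) = Ω ∪ B_{s(Ω,t)}` in the
symmetric-difference pseudometric (Proposition 2.1 of the paper). -/
theorem volume_adjustment_continuous
    {X : Type*} [MeasurableSpace X] (μ : Measure X) [IsFiniteMeasure μ]
    (𝔥 : ℝ) (h𝔥 : 𝔥 = (μ Set.univ).toReal / 2)
    (B : ℝ → Set X)
    (hBmeas : ∀ s ∈ Set.Icc (0:ℝ) 𝔥, MeasurableSet (B s))
    (hBmono : ∀ s ∈ Set.Icc (0:ℝ) 𝔥, ∀ s' ∈ Set.Icc (0:ℝ) 𝔥, s ≤ s' → B s ⊆ B s')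
    (hBvol : ∀ s ∈ Set.Icc (0:ℝ) 𝔥, (μ (B s)).toReal = s)
    (s : Set X → ℝ → ℝ)
    (hs_mem : ∀ Ω : Set X, MeasurableSet Ω → (μ Ω).toReal ≤ 𝔥 →
      ∀ t ∈ Set.Icc (0:ℝ) 1, s Ω t ∈ Set.Icc (0:ℝ) 𝔥)
    (hs_vol : ∀ Ω : Set X, MeasurableSet Ω → (μ Ω).toReal ≤ 𝔥 →
      ∀ t ∈ Set.Icc (0:ℝ) 1,
        (μ (Ω ∪ B (s Ω t))).toReal = (μ Ω).toReal + t * (𝔥 - (μ Ω).toReal)) :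
    ∀ Ω : Set X, MeasurableSet Ω → (μ Ω).toReal ≤ 𝔥 →
    ∀ t ∈ Set.Icc (0:ℝ) 1, ∀ ε₀ > (0:ℝ),
    ∃ δ > (0:ℝ), ∀ Θ : Set X, MeasurableSet Θ → (μ Θ).toReal ≤ 𝔥 →
      ∀ r ∈ Set.Icc (0:ℝ) 1,
        (μ (symmDiff Ω Θ)).toReal < δ → |t - r| < δ →
        (μ (symmDiff (Ω ∪ B (s Ω t)) (Θ ∪ B (s Θ r)))).toReal < ε₀ := by
  intro Ω hΩ hΩh t ht ε hε
  have h0 : 0 ≤ 𝔥 := ENNReal.toReal_nonneg.trans hΩh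
  refine ⟨ε / (4 + 𝔥), by positivity, ?_⟩
  intro Θ hΘ hΘh r hr hd htr
  have ha := hs_mem Ω hΩ hΩh t ht
  have hb := hs_mem Θ hΘ hΘh r hr
  have hva := hs_vol Ω hΩ hΩh t ht
  have hvb := hs_vol Θ hΘ hΘh r hr
  have hma := hBmeas _ ha
  have hmb := hBmeas _ hb
  have hm1 := hBmono _ ha _ hb
  have hm2 := hBmono _ hb _ ha
  generalize s Ω t = a at *
  generalize s Θ r = b at *
  have hδ : ε / (4 + 𝔥) * (4 + 𝔥) = ε := by field_simp
  have hδ0 : 0 < ε / (4 + 𝔥) := by positivity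
  generalize ε / (4 + 𝔥) = δ at *
  simp only [← measureReal_def] at *
  have k1 := aux_le μ (symmDiff (Ω ∪ B a) (Θ ∪ B b)) (symmDiff Ω Θ)
    (symmDiff (Ω ∪ B a) (Ω ∪ B b)) (by
      intro x; simp only [Set.mem_symmDiff, Set.mem_union]; tauto)
  have k2 := aux_le μ Ω Θ (symmDiff Ω Θ) (by
      intro x; simp only [Set.mem_symmDiff, Set.mem_union]; tauto)
  have k3 := aux_le μ Θ Ω (symmDiff Ω Θ) (by
      intro x; simp only [Set.mem_symmDiff, Set.mem_union]; tauto)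
  have k4 := aux_le μ (Ω ∪ B b) (Θ ∪ B b) (symmDiff Ω Θ) (by
      intro x; simp only [Set.mem_symmDiff, Set.mem_union]; tauto)
  have k5 := aux_le μ (Θ ∪ B b) (Ω ∪ B b) (symmDiff Ω Θ) (by
      intro x; simp only [Set.mem_symmDiff, Set.mem_union]; tauto)
  have k6 : μ.real (symmDiff (Ω ∪ B a) (Ω ∪ B b)) ≤ |μ.real (Ω ∪ B a) - μ.real (Ω ∪ B b)| := by
    rcases le_total a b with h | h
    · rw [aux_nested μ _ _ (hΩ.union hma) (Set.union_subset_union_right _ (hm1 h)), abs_sub_comm]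
      exact le_abs_self _
    · rw [symmDiff_comm,
        aux_nested μ _ _ (hΩ.union hmb) (Set.union_subset_union_right _ (hm2 h))]
      exact le_abs_self _
  have hΩ0 : 0 ≤ μ.real Ω := measureReal_nonneg
  have k7 : |μ.real (Ω ∪ B a) - μ.real (Θ ∪ B b)| ≤ δ + δ * 𝔥 := by
    have e : μ.real (Ω ∪ B a) - μ.real (Θ ∪ B b)
        = (μ.real Ω - μ.real Θ) * (1 - r) + (t - r) * (𝔥 - μ.real Ω) := by
      rw [hva, hvb]; ring
    rw [e]
    refine (abs_add_le _ _).trans (add_le_add ?_ ?_)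
    · rw [abs_mul, ← mul_one δ]
      refine mul_le_mul (abs_le.2 ⟨by linarith, by linarith⟩) ?_ (abs_nonneg _) hδ0.le
      exact abs_le.2 ⟨by linarith [hr.2], by linarith [hr.1]⟩
    · rw [abs_mul]
      refine mul_le_mul htr.le ?_ (abs_nonneg _) hδ0.le
      exact abs_le.2 ⟨by linarith, by linarith⟩
  have k8 : |μ.real (Ω ∪ B a) - μ.real (Ω ∪ B b)| ≤ δ + δ * 𝔥 + δ := by
    have := abs_le.1 k7
    exact abs_le.2 ⟨by linarith, by linarith⟩
  linarith
end

section
/- Let (X, μ) be a finite measure space, let 𝔥 ∈ [0, μ(X)], and let (B_s)_{s ∈ [0,𝔥]} be a family of measurable sets with B_s ⊆ B_{s′} whenever s ≤ s′ and μ(B_s) = s for every s ∈ [0,𝔥]. Then for every measurable set Ω with μ(Ω) ≤ 𝔥 and every t ∈ [0,1], there exists s ∈ [0,𝔥] such that μ(Ω ∪ B_s) = μ(Ω) + t(𝔥 − μ(Ω)). -/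
open MeasureTheory Set

/-- Existence of the volume-filling parameter: given a monotone family `B_s` with
`μ(B_s) = s` for `s ∈ [0,𝔥]`, for every `Ω` with `μ(Ω) ≤ 𝔥` and every `t ∈ [0,1]`
there is `s ∈ [0,𝔥]` with `μ(Ω ∪ B_s) = μ(Ω) + t(𝔥 − μ(Ω))`. -/
theorem exists_volume_filling_parameter
    {X : Type*} [MeasurableSpace X] (μ : Measure X) [IsFiniteMeasure μ]
    (𝔥 : ℝ) (h𝔥 : 𝔥 ∈ Set.Icc (0:ℝ) (μ Set.univ).toReal)
    (B : ℝ → Set X)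
    (hBmeas : ∀ s ∈ Set.Icc (0:ℝ) 𝔥, MeasurableSet (B s))
    (hBmono : ∀ s ∈ Set.Icc (0:ℝ) 𝔥, ∀ s' ∈ Set.Icc (0:ℝ) 𝔥, s ≤ s' → B s ⊆ B s')
    (hBvol : ∀ s ∈ Set.Icc (0:ℝ) 𝔥, (μ (B s)).toReal = s) :
    ∀ Ω : Set X, MeasurableSet Ω → (μ Ω).toReal ≤ 𝔥 →
    ∀ t ∈ Set.Icc (0:ℝ) 1,
      ∃ s ∈ Set.Icc (0:ℝ) 𝔥,
        (μ (Ω ∪ B s)).toReal = (μ Ω).toReal + t * (𝔥 - (μ Ω).toReal) := by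
  intro Ω hΩ hle t ht
  have key : ∀ s ∈ Set.Icc (0:ℝ) 𝔥, ∀ s' ∈ Set.Icc (0:ℝ) 𝔥, s ≤ s' →
      μ.real (Ω ∪ B s) ≤ μ.real (Ω ∪ B s') ∧
      μ.real (Ω ∪ B s') ≤ μ.real (Ω ∪ B s) + (s' - s) := by
    intro s hs s' hs' hss
    have hsub := hBmono s hs s' hs' hss
    refine ⟨measureReal_mono (union_subset_union_right _ hsub), ?_⟩
    have h1 : Ω ∪ B s' ⊆ (Ω ∪ B s) ∪ (B s' \ B s) := by
      intro x hx
      by_cases h : x ∈ B s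
      · exact Or.inl (Or.inr h)
      · rcases hx with hx | hx
        · exact Or.inl (Or.inl hx)
        · exact Or.inr ⟨hx, h⟩
    have h2 : μ.real (B s' \ B s) = s' - s := by
      rw [measureReal_diff hsub (hBmeas s hs)]
      simp only [Measure.real, hBvol s hs, hBvol s' hs']
    have h3 : μ.real (Ω ∪ B s') ≤ μ.real ((Ω ∪ B s) ∪ (B s' \ B s)) := measureReal_mono h1
    have h4 := measureReal_union_le (μ := μ) (Ω ∪ B s) (B s' \ B s)
    linarith
  have hcont : ContinuousOn (fun s => μ.real (Ω ∪ B s)) (Set.Icc 0 𝔥) := by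
    have : LipschitzOnWith 1 (fun s => μ.real (Ω ∪ B s)) (Set.Icc 0 𝔥) := by
      refine LipschitzOnWith.of_dist_le_mul ?_
      intro x hx y hy
      rw [NNReal.coe_one, one_mul, Real.dist_eq, Real.dist_eq]
      rcases le_total x y with h | h
      · have := key x hx y hy h
        rw [abs_of_nonpos (by linarith), abs_of_nonpos (by linarith)]
        linarith
      · have := key y hy x hx h
        rw [abs_of_nonneg (by linarith), abs_of_nonneg (by linarith)]
        linarith
    exact this.continuousOn
  have m0 : (0:ℝ) ∈ Set.Icc (0:ℝ) 𝔥 := ⟨le_rfl, h𝔥.1⟩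
  have m1 : 𝔥 ∈ Set.Icc (0:ℝ) 𝔥 := ⟨h𝔥.1, le_rfl⟩
  have e0 : μ.real (Ω ∪ B 0) ≤ (μ Ω).toReal := by
    have h := measureReal_union_le (μ := μ) Ω (B 0)
    simp only [Measure.real, hBvol 0 m0] at h ⊢
    linarith
  have e1 : 𝔥 ≤ μ.real (Ω ∪ B 𝔥) := by
    have h : μ.real (B 𝔥) ≤ μ.real (Ω ∪ B 𝔥) := measureReal_mono subset_union_right
    have h' : μ.real (B 𝔥) = 𝔥 := hBvol 𝔥 m1
    linarith
  have hi := intermediate_value_Icc h𝔥.1 hcont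
  have hm : (μ Ω).toReal + t * (𝔥 - (μ Ω).toReal) ∈
      Set.Icc (μ.real (Ω ∪ B 0)) (μ.real (Ω ∪ B 𝔥)) := by
    constructor
    · nlinarith [ht.1]
    · nlinarith [ht.2]
  obtain ⟨s, hs, h⟩ := hi hm
  exact ⟨s, hs, h⟩
end

section
/- Let W : ℝ → ℝ be continuous with W ≥ 0, such that W(x) = 0 if and only if x = 1 or x = −1, such that there exist δ > 0 and c > 0 with W(x) ≥ c(|x| − 1)² whenever ||x| − 1| ≤ δ, and such that there exists β ≥ 1 with W(x) ≥ x² whenever |x| ≥ β. Define Φ(s) = ∫₀^s √(W(τ)/2) dτ. Then there exists a constant C > 0 such that (x − y)² ≤ C·|Φ(x) − Φ(y)| for all x, y ∈ ℝ. -/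
open MeasureTheory

/-- The phase-transition profile primitive `Φ(s) = ∫₀^s √(W(τ)/2) dτ`. -/
noncomputable def phaseProfile (W : ℝ → ℝ) (s : ℝ) : ℝ :=
  ∫ τ in (0:ℝ)..s, Real.sqrt (W τ / 2)

lemma aux_lin (g : ℝ → ℝ) (hg : Continuous g) (k p a b e : ℝ) (hab : a ≤ b)
    (h : ∀ t ∈ Set.Icc a b, k * (e * (t - p)) ≤ g t) :
    k * e * ((b - p) ^ 2 - (a - p) ^ 2) / 2 ≤ ∫ t in a..b, g t := by
  have h1 : (∫ t in a..b, k * (e * (t - p))) ≤ ∫ t in a..b, g t :=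
    intervalIntegral.integral_mono_on hab
      ((by fun_prop : Continuous fun t : ℝ => k * (e * (t - p))).intervalIntegrable _ _)
      (hg.intervalIntegrable _ _) h
  have h2 : (∫ t in a..b, k * (e * (t - p))) = k * e * ((b - p) ^ 2 - (a - p) ^ 2) / 2 := by
    rw [intervalIntegral.integral_const_mul, intervalIntegral.integral_const_mul,
      intervalIntegral.integral_sub (continuous_id'.intervalIntegrable _ _)
        (continuous_const.intervalIntegrable _ _)]
    simp only [integral_id, intervalIntegral.integral_const, smul_eq_mul]
    ring
  linarith

lemma aux_abs (g : ℝ → ℝ) (hg : Continuous g) (k p a b : ℝ) (hk : 0 ≤ k) (hab : a ≤ b)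
    (h : ∀ t ∈ Set.Icc a b, k * |t - p| ≤ g t) :
    k * ((b - a) ^ 2 / 4) ≤ ∫ t in a..b, g t := by
  have hpos : ∀ t ∈ Set.Icc a b, k * (1 * (t - p)) ≤ g t := fun t ht =>
    le_trans (mul_le_mul_of_nonneg_left (by rw [one_mul]; exact le_abs_self _) hk) (h t ht)
  have hneg : ∀ t ∈ Set.Icc a b, k * (-1 * (t - p)) ≤ g t := fun t ht =>
    le_trans (mul_le_mul_of_nonneg_left (by rw [neg_one_mul]; exact neg_le_abs _) hk) (h t ht)
  rcases le_total p a with hp | hp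
  · have := aux_lin g hg k p a b 1 hab hpos
    have h3 : (b - a) ^ 2 / 4 ≤ ((b - p) ^ 2 - (a - p) ^ 2) / 2 := by
      nlinarith [mul_nonneg (sub_nonneg.2 hab) (sub_nonneg.2 hp), sq_nonneg (b - a)]
    nlinarith [mul_le_mul_of_nonneg_left h3 hk]
  rcases le_total b p with hp2 | hp2
  · have := aux_lin g hg k p a b (-1) hab hneg
    have h3 : (b - a) ^ 2 / 4 ≤ ((a - p) ^ 2 - (b - p) ^ 2) / 2 := by
      nlinarith [mul_nonneg (sub_nonneg.2 hab) (sub_nonneg.2 hp2), sq_nonneg (b - a)]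
    nlinarith [mul_le_mul_of_nonneg_left h3 hk]
  · have e1 := aux_lin g hg k p a p (-1) hp fun t ht => hneg t ⟨ht.1, ht.2.trans hp2⟩
    have e2 := aux_lin g hg k p p b 1 hp2 fun t ht => hpos t ⟨hp.trans ht.1, ht.2⟩
    have e3 := intervalIntegral.integral_add_adjacent_intervals (μ := volume)
      (hg.intervalIntegrable a p) (hg.intervalIntegrable p b)
    have h3 : (b - a) ^ 2 / 4 ≤ ((a - p) ^ 2 + (b - p) ^ 2) / 2 := by
      nlinarith [sq_nonneg (b - p - (p - a))]
    nlinarith [mul_le_mul_of_nonneg_left h3 hk]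

lemma aux_full (g : ℝ → ℝ) (hg : Continuous g) (k a b : ℝ) (hk : 0 ≤ k) (hab : a ≤ b)
    (h : ∀ t, k * |(|t| - 1)| ≤ g t) :
    k * ((b - a) ^ 2 / 8) ≤ ∫ t in a..b, g t := by
  have hpos : ∀ t, 0 ≤ t → k * |t - 1| ≤ g t := fun t ht => by
    have := h t
    rwa [abs_of_nonneg ht] at this
  have hneg : ∀ t, t ≤ 0 → k * |t - (-1)| ≤ g t := fun t ht => by
    have := h t
    rw [abs_of_nonpos ht, ← abs_neg] at this
    convert this using 3
    ring
  have hs : 0 ≤ k * (b - a) ^ 2 := by positivity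
  rcases le_total 0 a with ha | ha
  · have := aux_abs g hg k 1 a b hk hab fun t ht => hpos t (ha.trans ht.1)
    linarith
  rcases le_total b 0 with hb | hb
  · have := aux_abs g hg k (-1) a b hk hab fun t ht => hneg t (ht.2.trans hb)
    linarith
  · have e1 := aux_abs g hg k (-1) a 0 hk ha fun t ht => hneg t ht.2
    have e2 := aux_abs g hg k 1 0 b hk hb fun t ht => hpos t ht.1
    have e3 := intervalIntegral.integral_add_adjacent_intervals (μ := volume)
      (hg.intervalIntegrable a 0) (hg.intervalIntegrable 0 b)
    have h3 : (b - a) ^ 2 / 8 ≤ (0 - a) ^ 2 / 4 + (b - 0) ^ 2 / 4 := by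
      nlinarith [sq_nonneg (b + a)]
    nlinarith [mul_le_mul_of_nonneg_left h3 hk]

lemma aux_W (W : ℝ → ℝ) (hWc : Continuous W) (hWnn : ∀ x, 0 ≤ W x)
    (hWzero : ∀ x, W x = 0 ↔ x = 1 ∨ x = -1)
    (δ c : ℝ) (hδ : 0 < δ) (hc : 0 < c)
    (hWlocal : ∀ x : ℝ, |(|x| - 1)| ≤ δ → c * (|x| - 1) ^ 2 ≤ W x)
    (β : ℝ) (hβ : 1 ≤ β)
    (hWgrowth : ∀ x : ℝ, β ≤ |x| → x ^ 2 ≤ W x) :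
    ∃ m > 0, ∀ x, m * (|x| - 1) ^ 2 ≤ W x := by
  have hK : IsCompact (Set.Icc (-β) β ∩ {x : ℝ | δ ≤ |(|x| - 1)|}) :=
    isCompact_Icc.inter_right (isClosed_le continuous_const (by fun_prop))
  obtain ⟨w, hw, hwK⟩ : ∃ w > 0, ∀ x ∈ Set.Icc (-β) β ∩ {x : ℝ | δ ≤ |(|x| - 1)|}, w ≤ W x := by
    rcases Set.eq_empty_or_nonempty (Set.Icc (-β) β ∩ {x : ℝ | δ ≤ |(|x| - 1)|}) with h | h
    · exact ⟨1, one_pos, fun x hx => by rw [h] at hx; exact hx.elim⟩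
    · obtain ⟨x0, hx0, hmin⟩ := hK.exists_isMinOn h hWc.continuousOn
      refine ⟨W x0, lt_of_le_of_ne (hWnn _) fun h0 => ?_, fun x hx => hmin hx⟩
      have h2 := hx0.2
      simp only [Set.mem_ofPred_eq] at h2
      rcases (hWzero x0).1 h0.symm with h1 | h1 <;> · rw [h1] at h2; norm_num at h2; linarith
  refine ⟨min c (min 1 (w / β ^ 2)), by positivity, fun x => ?_⟩
  have hsq := sq_nonneg (|x| - 1)
  have hx0 := abs_nonneg x
  rcases le_total |(|x| - 1)| δ with h | h
  · exact (mul_le_mul_of_nonneg_right (min_le_left _ _) hsq).trans (hWlocal x h)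
  rcases le_total β |x| with hb | hb
  · refine (mul_le_mul_of_nonneg_right ((min_le_right _ _).trans (min_le_left _ _)) hsq).trans
      (le_trans ?_ (hWgrowth x hb))
    rw [← sq_abs x]
    nlinarith
  · refine (mul_le_mul_of_nonneg_right ((min_le_right _ _).trans (min_le_right _ _)) hsq).trans
      (le_trans ?_ (hwK x ⟨abs_le.1 hb, h⟩))
    have : (|x| - 1) ^ 2 ≤ β ^ 2 := by
      apply sq_le_sq'  <;> linarith
    rw [div_mul_eq_mul_div, div_le_iff₀ (by positivity)]
    exact mul_le_mul_of_nonneg_left this hw.le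

/-- Lemma 5.2 of the paper: under the stated hypotheses on the double-well potential `W`,
there is `C > 0` with `(x − y)² ≤ C·|Φ(x) − Φ(y)|` for all `x, y ∈ ℝ`. -/
theorem sq_le_const_mul_abs_phaseProfile_sub
    (W : ℝ → ℝ) (hWc : Continuous W) (hWnn : ∀ x, 0 ≤ W x)
    (hWzero : ∀ x, W x = 0 ↔ x = 1 ∨ x = -1)
    (δ c : ℝ) (hδ : 0 < δ) (hc : 0 < c)
    (hWlocal : ∀ x : ℝ, |(|x| - 1)| ≤ δ → c * (|x| - 1) ^ 2 ≤ W x)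
    (β : ℝ) (hβ : 1 ≤ β)
    (hWgrowth : ∀ x : ℝ, β ≤ |x| → x ^ 2 ≤ W x) :
    ∃ C > (0:ℝ), ∀ x y : ℝ,
      (x - y) ^ 2 ≤ C * |phaseProfile W x - phaseProfile W y| := by
  obtain ⟨m, hm, hmW⟩ := aux_W W hWc hWnn hWzero δ c hδ hc hWlocal β hβ hWgrowth
  have hg : Continuous fun t => Real.sqrt (W t / 2) := by fun_prop
  have hk : 0 < Real.sqrt (m / 2) := by positivity
  have hlow : ∀ t, Real.sqrt (m / 2) * |(|t| - 1)| ≤ Real.sqrt (W t / 2) := fun t => by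
    rw [← Real.sqrt_sq_eq_abs, ← Real.sqrt_mul (by positivity)]
    apply Real.sqrt_le_sqrt
    linarith [hmW t]
  have key : ∀ x y : ℝ, x ≤ y →
      (y - x) ^ 2 ≤ 8 / Real.sqrt (m / 2) * |phaseProfile W y - phaseProfile W x| := by
    intro x y hxy
    have h1 := aux_full _ hg _ x y hk.le hxy hlow
    have h2 : phaseProfile W y - phaseProfile W x = ∫ t in x..y, Real.sqrt (W t / 2) :=
      intervalIntegral.integral_interval_sub_left (hg.intervalIntegrable _ _)
        (hg.intervalIntegrable _ _)
    rw [← h2] at h1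
    have h3 := h1.trans (le_abs_self _)
    rw [div_mul_eq_mul_div, le_div_iff₀ hk]
    linarith
  refine ⟨8 / Real.sqrt (m / 2), by positivity, fun x y => ?_⟩
  rcases le_total x y with h | h
  · have := key x y h
    rw [abs_sub_comm]
    linarith [sq_nonneg (x - y), (by ring : (x - y) ^ 2 = (y - x) ^ 2)]
  · exact key y x h
end
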